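/- Let n be a positive integer, H a complex Hilbert space, Σ ⊆ 𝔽ₙ⁺ a nonempty admissible set, and M : Σ → H a map. Then there exists a row contraction (T₁,…,Tₙ) on H such that T_σ (M(g₀)) = M(σ) for every σ ∈ Σ — equivalently, M is a vector-valued moment map for Poisson transforms on C*(S₁,…,Sₙ) — if and only if K₃ ≤ K₄. -/

import Mathlib

/-!
Statement 2: vector-valued moment problem for Poisson transforms on the
Cuntz–Toeplitz algebra, stated in the equivalent row-contraction form.
-/

open scoped InnerProductSpace ComplexOrder ComplexInnerProductSpace Classical
open ContinuousLinearMap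

noncomputable section

/-- Words in the free monoid `𝔽ₙ⁺` on `n` generators (the empty word is `g₀`). -/
abbrev Wd (n : ℕ) := List (Fin n)

/-- A set `Σ ⊆ 𝔽ₙ⁺` is admissible if `αβ ∈ Σ` implies `β ∈ Σ`. -/
def Adm {n : ℕ} (S : Set (Wd n)) : Prop := ∀ α β : Wd n, α ++ β ∈ S → β ∈ S

/-- `σ ≤ α` : `σ` is a prefix of `α`, i.e. `α = στ` for some `τ`. -/
def pfx {n : ℕ} (σ α : Wd n) : Prop := ∃ τ : Wd n, α = σ ++ τ

/-- `α ∖ σ` : the unique `τ` with `α = στ` when `σ ≤ α`. -/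
def wq {n : ℕ} (α σ : Wd n) : Wd n := α.drop σ.length

variable {H : Type*} [NormedAddCommGroup H] [InnerProductSpace ℂ H] [CompleteSpace H]

/-- `T_α = T_{i₁} ⋯ T_{i_k}` for a word `α = g_{i₁} ⋯ g_{i_k}`, `T_{g₀} = I`. -/
def wordOp {n : ℕ} (T : Fin n → (H →L[ℂ] H)) (α : Wd n) : H →L[ℂ] H := (α.map T).prod

/-- `(T₁, …, Tₙ)` is a row contraction: `T₁T₁* + ⋯ + TₙTₙ* ≤ I`. -/
def RowContraction {n : ℕ} (T : Fin n → (H →L[ℂ] H)) : Prop :=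
  ((1 : H →L[ℂ] H) - ∑ i, T i * adjoint (T i)).IsPositive

/-- A complex-valued kernel `k` on `X` is positive semidefinite if
`∑_{x,y} k(x,y) c(y) conj(c(x)) ≥ 0` for all finitely supported `c : X → ℂ`. -/
def CKerPSD {X : Type*} (k : X → X → ℂ) : Prop :=
  ∀ (s : Finset X) (c : X → ℂ),
    0 ≤ ∑ x ∈ s, ∑ y ∈ s, k x y * c y * (starRingEnd ℂ) (c x)

/-- `K₃((α,β),(σ,γ)) = ⟨M(σγ), M(αβ)⟩` (inner product linear in its first argument). -/
def K3 {n : ℕ} (M : Wd n → H) (x y : Wd n × Wd n) : ℂ :=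
  ⟪M (x.1 ++ x.2), M (y.1 ++ y.2)⟫_ℂ

/-- `K₄((α,β),(σ,γ)) = ⟨M((σ∖α)γ), M(β)⟩` if `α ≤ σ`, `⟨M(γ), M((α∖σ)β)⟩` if `σ < α`,
and `0` otherwise (inner product linear in its first argument). -/
def K4 {n : ℕ} (M : Wd n → H) (x y : Wd n × Wd n) : ℂ :=
  if pfx x.1 y.1 then ⟪M x.2, M (wq y.1 x.1 ++ y.2)⟫_ℂ
  else if pfx y.1 x.1 then ⟪M (wq x.1 y.1 ++ x.2), M y.2⟫_ℂ
  else 0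

theorem rowContraction_iff_sum_norm_adjoint_sq_le {n : ℕ} {T : Fin n → (H →L[ℂ] H)} :
    RowContraction T ↔ ∀ x, ∑ i, ‖adjoint (T i) x‖ ^ 2 ≤ ‖x‖ ^ 2 := by
  have key (x : H) : ((1 : H →L[ℂ] H) - ∑ i, T i * adjoint (T i)).reApplyInnerSelf x =
      ‖x‖ ^ 2 - ∑ i, ‖adjoint (T i) x‖ ^ 2 := by
    simp only [reApplyInnerSelf_apply, sub_apply, one_apply_eq_self, inner_sub_left, sum_apply,
      sum_inner, mul_apply_eq_comp, map_sub, map_sum, inner_self_eq_norm_sq]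
    congr 1
    refine Finset.sum_congr rfl fun i _ => ?_
    rw [← adjoint_inner_right, inner_self_eq_norm_sq]
  have hsa : IsSelfAdjoint ((1 : H →L[ℂ] H) - ∑ i, T i * adjoint (T i)) :=
    (IsSelfAdjoint.one _).sub <| isSelfAdjoint_sum _ fun i _ => .mul_star_self (T i)
  simp only [RowContraction, isPositive_def', hsa, true_and, key, sub_nonneg]

theorem RowContraction.norm_sum_apply_sq_le {n : ℕ} {T : Fin n → (H →L[ℂ] H)}
    (hT : RowContraction T) (x : Fin n → H) : ‖∑ i, T i (x i)‖ ^ 2 ≤ ∑ i, ‖x i‖ ^ 2 := by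
  set z := ∑ i, T i (x i) with hz
  have hadj := rowContraction_iff_sum_norm_adjoint_sq_le.1 hT z
  have hle : ‖z‖ ^ 2 ≤ ∑ i, ‖adjoint (T i) z‖ * ‖x i‖ := by
    rw [← inner_self_eq_norm_sq (𝕜 := ℂ)]
    nth_rewrite 2 [hz]
    rw [inner_sum, map_sum]
    refine Finset.sum_le_sum fun i _ => ?_
    rw [← adjoint_inner_left]
    exact re_inner_le_norm _ _
  have hcs := Finset.sum_mul_sq_le_sq_mul_sq Finset.univ
    (fun i => ‖adjoint (T i) z‖) (fun i => ‖x i‖)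
  have hx : 0 ≤ ∑ i, ‖x i‖ ^ 2 := by positivity
  have h4 : ‖z‖ ^ 2 * ‖z‖ ^ 2 ≤ ‖z‖ ^ 2 * ∑ i, ‖x i‖ ^ 2 := by
    calc ‖z‖ ^ 2 * ‖z‖ ^ 2 ≤ (∑ i, ‖adjoint (T i) z‖ * ‖x i‖) ^ 2 := by
          rw [← sq]; gcongr
      _ ≤ _ := hcs.trans (by gcongr)
  rcases (sq_nonneg ‖z‖).eq_or_lt with h | h
  · rw [← h]; exact hx
  · exact le_of_mul_le_mul_left h4 h

theorem RowContraction.of_norm_le_one {n : ℕ} (L : PiLp 2 (fun _ : Fin n => H) →L[ℂ] H)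
    (hL : ∀ x, ‖L x‖ ≤ ‖x‖) :
    RowContraction fun i => L ∘L (PiLp.continuousLinearEquiv 2 ℂ (fun _ : Fin n => H)).symm ∘L
      ContinuousLinearMap.single ℂ (fun _ : Fin n => H) i := by
  rw [rowContraction_iff_sum_norm_adjoint_sq_le]
  intro x
  set T : Fin n → (H →L[ℂ] H) := fun i =>
    L ∘L (PiLp.continuousLinearEquiv 2 ℂ (fun _ : Fin n => H)).symm ∘L
      ContinuousLinearMap.single ℂ (fun _ : Fin n => H) i
  set y : PiLp 2 (fun _ : Fin n => H) := WithLp.toLp 2 fun i => adjoint (T i) x with hy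
  have hnorm : ‖y‖ ^ 2 = ∑ i, ‖adjoint (T i) x‖ ^ 2 := PiLp.norm_sq_eq_of_L2 _ y
  have hLy : L y = ∑ i, T i (adjoint (T i) x) := by
    have : y = ∑ i, PiLp.single 2 i (adjoint (T i) x) := by
      apply WithLp.ofLp_injective
      simp [hy, Finset.univ_sum_single]
    rw [this, map_sum]
    rfl
  have hle : ‖y‖ ^ 2 ≤ ‖x‖ * ‖y‖ := by
    calc ‖y‖ ^ 2 = RCLike.re ⟪x, L y⟫_ℂ := by
          rw [hnorm, hLy, inner_sum, map_sum]
          refine Finset.sum_congr rfl fun i _ => ?_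
          rw [← adjoint_inner_left, inner_self_eq_norm_sq]
      _ ≤ ‖x‖ * ‖L y‖ := re_inner_le_norm _ _
      _ ≤ ‖x‖ * ‖y‖ := by gcongr; exact hL y
  rw [← hnorm]
  nlinarith [norm_nonneg x, norm_nonneg y, sq_nonneg (‖x‖ - ‖y‖)]

/-- A contractive assignment of vectors `u i ↦ w i` extends to a contraction. -/
theorem exists_contraction_apply_eq {ι E : Type*} [NormedAddCommGroup E] [InnerProductSpace ℂ E]
    [CompleteSpace E] (u : ι → E) (w : ι → H)
    (h : ∀ c : ι →₀ ℂ, ‖Finsupp.linearCombination ℂ w c‖ ≤ ‖Finsupp.linearCombination ℂ u c‖) :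
    ∃ L : E →L[ℂ] H, (∀ x, ‖L x‖ ≤ ‖x‖) ∧ ∀ i, L (u i) = w i := by
  set f := Finsupp.linearCombination ℂ u
  set K := (LinearMap.range f).topologicalClosure
  have : CompleteSpace K :=
    (Submodule.isClosed_topologicalClosure _).completeSpace_coe
  have hK (c : ι →₀ ℂ) : f c ∈ K :=
    Submodule.le_topologicalClosure _ (LinearMap.mem_range_self f c)
  set e : (ι →₀ ℂ) →ₗ[ℂ] K := f.codRestrict K hK with he
  have hdense : DenseRange e := by
    rw [DenseRange, Subtype.dense_iff]
    intro x hx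
    rw [← Set.range_comp]
    exact hx
  have hnorm (c : ι →₀ ℂ) : ‖Finsupp.linearCombination ℂ w c‖ ≤ 1 * ‖e c‖ := by
    rw [one_mul]; exact h c
  refine ⟨(Finsupp.linearCombination ℂ w).extendOfNorm e ∘L K.orthogonalProjectionOnto,
    fun x => ?_, fun i => ?_⟩
  · refine (LinearMap.norm_extendOfNorm_apply_le hdense 1 hnorm _).trans ?_
    rw [one_mul]
    exact K.norm_orthogonalProjectionOnto_apply_le x
  · have hu : u i = e (Finsupp.single i 1) := by simp [he, f]
    rw [comp_apply, hu, Submodule.orthogonalProjectionOnto_mem_subspace_eq_self,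
      LinearMap.extendOfNorm_eq hdense ⟨1, hnorm⟩]
    simp

theorem CKerPSD.comp_injective {X Y : Type*} {k : X → X → ℂ} (hk : CKerPSD k) {f : Y → X}
    (hf : f.Injective) : CKerPSD fun x y => k (f x) (f y) := by
  intro s c
  simpa [hf.extend_apply] using hk (s.map ⟨f, hf⟩) (Function.extend f c 0)

theorem sum_inner_mul_mul_conj {X E : Type*} [NormedAddCommGroup E] [InnerProductSpace ℂ E]
    (s : Finset X) (c : X → ℂ) (u : X → E) :
    ∑ x ∈ s, ∑ y ∈ s, ⟪u x, u y⟫_ℂ * c y * (starRingEnd ℂ) (c x) =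
      ⟪∑ x ∈ s, c x • u x, ∑ x ∈ s, c x • u x⟫_ℂ := by
  rw [sum_inner]
  refine Finset.sum_congr rfl fun x _ => ?_
  rw [inner_sum]
  refine Finset.sum_congr rfl fun y _ => ?_
  rw [inner_smul_left, inner_smul_right]
  ring

theorem K4_cons_cons {n : ℕ} (M : Wd n → H) (i j : Fin n) (α β σ γ : Wd n) :
    K4 M (i :: α, β) (j :: σ, γ) = if i = j then K4 M (α, β) (σ, γ) else 0 := by
  by_cases hij : i = j
  · subst hij
    simp only [K4, pfx, wq, List.cons_append, List.cons.injEq, true_and, List.length_cons,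
      List.drop_succ_cons, if_true]
    congr!
  · simp [K4, pfx, hij, Ne.symm hij]

@[simp]
theorem K4_nil_left {n : ℕ} (M : Wd n → H) (β σ γ : Wd n) :
    K4 M ([], β) (σ, γ) = ⟪M β, M (σ ++ γ)⟫_ℂ := by
  simp [K4, pfx, wq]

@[simp]
theorem K4_cons_nil {n : ℕ} (M : Wd n → H) (i : Fin n) (α β γ : Wd n) :
    K4 M (i :: α, β) ([], γ) = ⟪M (i :: α ++ β), M γ⟫_ℂ := by
  simp [K4, pfx, wq]

theorem exists_rowContraction_of_CKerPSD {n : ℕ} {S : Set (Wd n)} {M : Wd n → H}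
    (h : CKerPSD (fun x y : {p : Wd n × Wd n // p.1 ++ p.2 ∈ S} =>
      K4 M x.1 y.1 - K3 M x.1 y.1)) :
    ∃ T : Fin n → (H →L[ℂ] H), RowContraction T ∧
      ∀ i σ, i :: σ ∈ S → T i (M σ) = M (i :: σ) := by
  let f : {p : Fin n × Wd n // p.1 :: p.2 ∈ S} → {p : Wd n × Wd n // p.1 ++ p.2 ∈ S} :=
    fun p => ⟨([p.1.1], p.1.2), p.2⟩
  have hf : f.Injective := by
    rintro ⟨⟨i, σ⟩, _⟩ ⟨⟨j, τ⟩, _⟩ hp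
    simpa [f] using hp
  have hk := h.comp_injective hf
  let u : {p : Fin n × Wd n // p.1 :: p.2 ∈ S} → PiLp 2 (fun _ : Fin n => H) :=
    fun p => PiLp.single 2 p.1.1 (M p.1.2)
  let w : {p : Fin n × Wd n // p.1 :: p.2 ∈ S} → H := fun p => M (p.1.1 :: p.1.2)
  have hker (p q) : K4 M (f p).1 (f q).1 - K3 M (f p).1 (f q).1 =
      ⟪u p, u q⟫_ℂ - ⟪w p, w q⟫_ℂ := by
    congr 1
    obtain ⟨⟨i, σ⟩, _⟩ := p
    obtain ⟨⟨j, τ⟩, _⟩ := q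
    simp only [f, u, K4_cons_cons, K4_nil_left, List.nil_append, PiLp.inner_apply,
      PiLp.ofLp_single]
    rw [Finset.sum_eq_single i (fun k _ hk => by simp [hk]) (by simp)]
    by_cases hij : i = j
    · subst hij; simp
    · simp [hij]
  obtain ⟨L, hL, hLu⟩ := exists_contraction_apply_eq u w fun c => by
    have := hk c.support c
    simp only [hker, sub_mul, Finset.sum_sub_distrib, sum_inner_mul_mul_conj, sub_nonneg,
      inner_self_eq_norm_sq_to_K] at this
    refine le_of_sq_le_sq ?_ (norm_nonneg _)
    exact_mod_cast this
  exact ⟨_, RowContraction.of_norm_le_one L hL, fun i σ hσ => hLu ⟨(i, σ), hσ⟩⟩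

/-- The image of `S_α* S_σ` under the Poisson transform of the row contraction `T`. -/
def poissonOp {n : ℕ} (T : Fin n → (H →L[ℂ] H)) : Wd n → Wd n → (H →L[ℂ] H)
  | [], σ => wordOp T σ
  | i :: α, [] => adjoint (wordOp T (i :: α))
  | i :: α, j :: σ => if i = j then poissonOp T α σ else 0

@[simp]
theorem wordOp_nil {n : ℕ} (T : Fin n → (H →L[ℂ] H)) : wordOp T [] = 1 := rfl

@[simp]
theorem wordOp_cons {n : ℕ} (T : Fin n → (H →L[ℂ] H)) (i : Fin n) (α : Wd n) :
    wordOp T (i :: α) = T i * wordOp T α := by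
  simp [wordOp]

theorem wordOp_append {n : ℕ} (T : Fin n → (H →L[ℂ] H)) (α β : Wd n) :
    wordOp T (α ++ β) = wordOp T α * wordOp T β := by
  simp [wordOp]

theorem K4_orbit_eq_inner_poissonOp {n : ℕ} (T : Fin n → (H →L[ℂ] H)) (h : H)
    (α β σ γ : Wd n) :
    K4 (fun τ => wordOp T τ h) (α, β) (σ, γ) =
      ⟪wordOp T β h, poissonOp T α σ (wordOp T γ h)⟫_ℂ := by
  induction α generalizing σ with
  | nil => simp [poissonOp, wordOp_append]
  | cons i α ih =>
    cases σ with
    | nil => rw [K4_cons_nil, poissonOp, adjoint_inner_right, wordOp_append, mul_apply_eq_comp]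
    | cons j σ =>
      rw [K4_cons_cons, poissonOp]
      split_ifs with hij
      · exact ih σ
      · simp

theorem sum_ite_head_wordOp {n : ℕ} (T : Fin n → (H →L[ℂ] H)) (α : Wd n) (v : H) :
    wordOp T α v = (if α = [] then v else 0) +
      ∑ i, T i (wordOp T α.tail (if α.head? = some i then v else 0)) := by
  cases α with
  | nil => simp
  | cons j α =>
    simp only [List.head?_cons, Option.some.injEq, List.tail_cons]
    rw [Finset.sum_eq_single j (fun k _ hk => by simp [hk.symm]) (by simp)]
    simp

theorem inner_poissonOp_decomposition {n : ℕ} (T : Fin n → (H →L[ℂ] H)) (α σ : Wd n) (v w : H) :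
    ⟪v, poissonOp T α σ w⟫_ℂ - ⟪wordOp T α v, wordOp T σ w⟫_ℂ =
      (∑ i, ⟪if α.head? = some i then v else 0,
          poissonOp T α.tail σ.tail (if σ.head? = some i then w else 0)⟫_ℂ) -
        ⟪∑ i, T i (wordOp T α.tail (if α.head? = some i then v else 0)),
          ∑ i, T i (wordOp T σ.tail (if σ.head? = some i then w else 0))⟫_ℂ := by
  cases α with
  | nil => simp [poissonOp]
  | cons i α =>
    cases σ with
    | nil => simp [poissonOp, adjoint_inner_right]
    | cons j σ =>
      have hα := sum_ite_head_wordOp T (i :: α) v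
      have hσ := sum_ite_head_wordOp T (j :: σ) w
      simp only [reduceCtorEq, if_false, zero_add] at hα hσ
      rw [← hα, ← hσ]
      congr 1
      simp only [List.head?_cons, Option.some.injEq, List.tail_cons, poissonOp]
      rw [Finset.sum_eq_single i (fun k _ hk => by simp [hk.symm]) (by simp)]
      by_cases hij : i = j
      · simp [hij]
      · simp [hij, Ne.symm hij]

theorem RowContraction.poissonOp_schwarz {n : ℕ} {T : Fin n → (H →L[ℂ] H)}
    (hT : RowContraction T) {X : Type*} (s : Finset X) (N : ℕ) (a : X → Wd n) (v : X → H)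
    (ha : ∀ x ∈ s, (a x).length ≤ N) :
    0 ≤ ∑ x ∈ s, ∑ y ∈ s,
      (⟪v x, poissonOp T (a x) (a y) (v y)⟫_ℂ - ⟪wordOp T (a x) (v x), wordOp T (a y) (v y)⟫_ℂ) := by
  induction N generalizing a v with
  | zero =>
    refine (Finset.sum_eq_zero fun x hx => Finset.sum_eq_zero fun y hy => ?_).ge
    simp [List.length_eq_zero_iff.1 (Nat.le_zero.1 (ha x hx)),
      List.length_eq_zero_iff.1 (Nat.le_zero.1 (ha y hy)), poissonOp]
  | succ N ih =>
    let b (x : X) : Wd n := (a x).tail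
    let u (i : Fin n) (x : X) : H := if (a x).head? = some i then v x else 0
    let E (i : Fin n) : H := ∑ x ∈ s, wordOp T (b x) (u i x)
    have hsum : ∑ x ∈ s, ∑ y ∈ s, (⟪v x, poissonOp T (a x) (a y) (v y)⟫_ℂ -
          ⟪wordOp T (a x) (v x), wordOp T (a y) (v y)⟫_ℂ) =
        ∑ i, ∑ x ∈ s, ∑ y ∈ s, (⟪u i x, poissonOp T (b x) (b y) (u i y)⟫_ℂ -
          ⟪wordOp T (b x) (u i x), wordOp T (b y) (u i y)⟫_ℂ) +
        (∑ i, ⟪E i, E i⟫_ℂ - ⟪∑ i, T i (E i), ∑ i, T i (E i)⟫_ℂ) := by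
      have hE : ∑ i, T i (E i) = ∑ x ∈ s, ∑ i, T i (wordOp T (b x) (u i x)) := by
        simp only [E, map_sum]
        exact Finset.sum_comm
      have hEE (i : Fin n) : ⟪E i, E i⟫_ℂ = ∑ x ∈ s, ∑ y ∈ s,
          ⟪wordOp T (b x) (u i x), wordOp T (b y) (u i y)⟫_ℂ := by
        simp only [E, sum_inner]
        exact Finset.sum_congr rfl fun x _ => inner_sum _ _ _
      have hP : ∑ i, ∑ x ∈ s, ∑ y ∈ s, ⟪u i x, poissonOp T (b x) (b y) (u i y)⟫_ℂ =
          ∑ x ∈ s, ∑ y ∈ s, ∑ i, ⟪u i x, poissonOp T (b x) (b y) (u i y)⟫_ℂ := by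
        rw [Finset.sum_comm]
        exact Finset.sum_congr rfl fun x _ => Finset.sum_comm
      have hF (F : X → H) : ⟪∑ x ∈ s, F x, ∑ x ∈ s, F x⟫_ℂ = ∑ x ∈ s, ∑ y ∈ s, ⟪F x, F y⟫_ℂ := by
        rw [sum_inner]
        exact Finset.sum_congr rfl fun x _ => inner_sum _ _ _
      rw [hE, hF]
      simp only [inner_poissonOp_decomposition T (a _) (a _), Finset.sum_sub_distrib, hEE, hP]
      simp only [b, u]
      ring
    rw [hsum]
    refine add_nonneg (Finset.sum_nonneg fun i _ => ih b (u i) fun x hx => ?_) ?_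
    · have := ha x hx
      simp only [b, List.length_tail]
      omega
    · rw [sub_nonneg]
      simp only [inner_self_eq_norm_sq_to_K]
      exact_mod_cast hT.norm_sum_apply_sq_le E

theorem RowContraction.CKerPSD_orbit {n : ℕ} {T : Fin n → (H →L[ℂ] H)}
    (hT : RowContraction T) (h : H) :
    CKerPSD fun x y : Wd n × Wd n =>
      K4 (fun τ => wordOp T τ h) x y - K3 (fun τ => wordOp T τ h) x y := by
  intro s c
  convert hT.poissonOp_schwarz s (s.sup fun x => x.1.length) (fun x => x.1)
    (fun x => c x • wordOp T x.2 h) (fun x hx => Finset.le_sup (f := fun x => x.1.length) hx)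
    using 4 with x _ y _
  beta_reduce
  rw [show K4 (fun τ => wordOp T τ h) x y = _ from
    K4_orbit_eq_inner_poissonOp T h x.1 x.2 y.1 y.2]
  simp only [K3, wordOp_append, mul_apply_eq_comp, map_smul, inner_smul_left, inner_smul_right]
  ring

theorem K4_congr {n : ℕ} {S : Set (Wd n)} (hadm : Adm S) {M M' : Wd n → H}
    (hM : Set.EqOn M M' S) {x y : Wd n × Wd n} (hx : x.1 ++ x.2 ∈ S) (hy : y.1 ++ y.2 ∈ S) :
    K4 M x y = K4 M' x y := by
  obtain ⟨α, β⟩ := x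
  obtain ⟨σ, γ⟩ := y
  dsimp only at hx hy
  induction α generalizing σ with
  | nil => rw [K4_nil_left, K4_nil_left, hM (hadm [] β hx), hM hy]
  | cons i α ih =>
    cases σ with
    | nil => rw [K4_cons_nil, K4_cons_nil, hM hx, hM (hadm [] γ hy)]
    | cons j σ =>
      rw [K4_cons_cons, K4_cons_cons, ih (hadm [i] _ hx) σ (hadm [j] _ hy)]

/-- `M : Σ → H` is a vector-valued moment map for Poisson transforms
on `C*(S₁,…,Sₙ)` (equivalently: there is a row contraction `T` with `T_σ(M(g₀)) = M(σ)`
for all `σ ∈ Σ`) iff `K₃ ≤ K₄` as complex kernels on `Λ_Σ`. -/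
theorem stmt2 {n : ℕ} (hn : 0 < n) (S : Set (Wd n)) (hne : S.Nonempty) (hadm : Adm S)
    (M : Wd n → H) :
    (∃ T : Fin n → (H →L[ℂ] H), RowContraction T ∧
        ∀ σ ∈ S, wordOp T σ (M ([] : Wd n)) = M σ) ↔
      CKerPSD (fun x y : {p : Wd n × Wd n // p.1 ++ p.2 ∈ S} =>
        K4 M x.1 y.1 - K3 M x.1 y.1) := by
  constructor
  · rintro ⟨T, hT, hTM⟩
    have hM : Set.EqOn M (fun τ => wordOp T τ (M [])) S := fun σ hσ => (hTM σ hσ).symm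
    convert (hT.CKerPSD_orbit (M [])).comp_injective
      (Subtype.val_injective (p := fun p : Wd n × Wd n => p.1 ++ p.2 ∈ S)) using 3 with x y
    rw [K4_congr hadm hM x.2 y.2, K3, K3, hM x.2, hM y.2]
  · intro h
    obtain ⟨T, hT, hTM⟩ := exists_rowContraction_of_CKerPSD h
    refine ⟨T, hT, fun σ => ?_⟩
    induction σ with
    | nil => simp
    | cons i σ ih =>
      intro hσ
      rw [wordOp_cons, mul_apply_eq_comp, ih (hadm [i] σ hσ), hTM i σ hσ]

end
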